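/- Let k_1, k_2 be nonnegative integers, n = k_1 + k_2, and let R = ℝ[x, y]/(x^{k_1+1}, y^{k_2+1}), graded by R_m = span{ x^i y^j : i + j = m }. Let ⟨·⟩ : R_n → ℝ be the linear map with ⟨x^{k_1} y^{k_2}⟩ = 1. Let a, b be positive reals and λ = a·x + b·y. Then for every integer m with 0 ≤ m ≤ n/2, the quadratic form h ↦ (−1)^m ⟨λ^{n−2m} h² ⟩ is positive definite on the primitive subspace { h ∈ R_m : λ^{n−2m+1} h = 0 }. -/

import Mathlib

open MvPolynomial

/-- The ideal `(x^{k₁+1}, y^{k₂+1})` in `ℝ[x, y]`. -/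
noncomputable abbrev projIdeal (k₁ k₂ : ℕ) : Ideal (MvPolynomial (Fin 2) ℝ) :=
  Ideal.span {(X 0 : MvPolynomial (Fin 2) ℝ) ^ (k₁ + 1), (X 1 : MvPolynomial (Fin 2) ℝ) ^ (k₂ + 1)}

/-- The ring `R = ℝ[x, y]/(x^{k₁+1}, y^{k₂+1})`. -/
abbrev QR (k₁ k₂ : ℕ) : Type :=
  MvPolynomial (Fin 2) ℝ ⧸ projIdeal k₁ k₂

/-- The graded piece `R_m`, spanned by the images of the monomials `x^i y^j`
with `i + j = m`. -/
noncomputable def Rm (k₁ k₂ m : ℕ) : Submodule ℝ (QR k₁ k₂) :=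
  Submodule.span ℝ { q : QR k₁ k₂ | ∃ i j : ℕ, i + j = m ∧
    q = Ideal.Quotient.mk (projIdeal k₁ k₂) (X 0 ^ i * X 1 ^ j) }

/-- The degree `r` homogenization `∑ Fᵢ xⁱ y^{r-i}` of `F`, evaluated at `x`, `y`. -/
noncomputable def homEval {A : Type*} [CommRing A] [Algebra ℝ A] (x y : A) (r : ℕ)
    (F : Polynomial ℝ) : A :=
  ∑ i ∈ Finset.range (r + 1), F.coeff i • (x ^ i * y ^ (r - i))

theorem coeff_one_sub_X_mul_succ (F : Polynomial ℝ) (i : ℕ) :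
    ((1 - Polynomial.X) * F).coeff (i + 1) = F.coeff (i + 1) - F.coeff i := by
  rw [sub_mul, one_mul, Polynomial.coeff_sub, Polynomial.coeff_X_mul]

theorem coeff_one_sub_X_mul_zero (F : Polynomial ℝ) :
    ((1 - Polynomial.X) * F).coeff 0 = F.coeff 0 := by
  simp [sub_mul]

theorem natDegree_one_sub_X_pow (N : ℕ) :
    ((1 - Polynomial.X : Polynomial ℝ) ^ N).natDegree = N := by
  have : (1 - Polynomial.X : Polynomial ℝ).natDegree = 1 := by
    rw [← Polynomial.natDegree_neg, neg_sub]
    exact Polynomial.natDegree_X_sub_C (1 : ℝ)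
  rw [Polynomial.natDegree_pow, this, mul_one]

theorem one_sub_X_ne_zero : (1 - Polynomial.X : Polynomial ℝ) ≠ 0 := by
  intro h
  simpa using congrArg (Polynomial.coeff · 0) h

theorem sub_mul_homEval {A : Type*} [CommRing A] [Algebra ℝ A] (x y : A) (r : ℕ)
    (F : Polynomial ℝ) (hF : F.natDegree ≤ r) :
    (y - x) * homEval x y r F = homEval x y (r + 1) ((1 - Polynomial.X) * F) := by
  have hy : y * homEval x y r F
      = ∑ i ∈ Finset.range (r + 2), F.coeff i • (x ^ i * y ^ (r + 1 - i)) := by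
    rw [Finset.sum_range_succ, Polynomial.coeff_eq_zero_of_natDegree_lt (by omega), zero_smul,
      add_zero, homEval, Finset.mul_sum]
    refine Finset.sum_congr rfl fun i hi => ?_
    rw [Finset.mem_range] at hi
    rw [show r + 1 - i = (r - i) + 1 by omega, pow_succ, mul_smul_comm]
    congr 1
    ring
  have hx : x * homEval x y r F
      = ∑ i ∈ Finset.range (r + 2),
        (Polynomial.X * F).coeff i • (x ^ i * y ^ (r + 1 - i)) := by
    rw [Finset.sum_range_succ', Polynomial.coeff_X_mul_zero, zero_smul, add_zero, homEval,
      Finset.mul_sum]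
    refine Finset.sum_congr rfl fun i _ => ?_
    rw [Polynomial.coeff_X_mul, show r + 1 - (i + 1) = r - i by omega, mul_smul_comm]
    congr 1
    ring
  rw [sub_mul, hy, hx, ← Finset.sum_sub_distrib, homEval]
  refine Finset.sum_congr rfl fun i _ => ?_
  rw [← sub_smul, sub_mul, one_mul, Polynomial.coeff_sub]

theorem sub_pow_mul_homEval {A : Type*} [CommRing A] [Algebra ℝ A] (x y : A) (r : ℕ)
    (F : Polynomial ℝ) (hF : F.natDegree ≤ r) (s : ℕ) :
    (y - x) ^ s * homEval x y r F = homEval x y (r + s) ((1 - Polynomial.X) ^ s * F) := by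
  induction s with
  | zero => simp
  | succ s ih =>
    have hdeg : ((1 - Polynomial.X) ^ s * F).natDegree ≤ r + s := by
      refine Polynomial.natDegree_mul_le.trans ?_
      rw [natDegree_one_sub_X_pow]
      omega
    rw [pow_succ', mul_assoc, ih, sub_mul_homEval _ _ _ _ hdeg, pow_succ', mul_assoc, add_assoc]

theorem map_homEval_mul {A : Type*} [CommRing A] [Algebra ℝ A] {x y : A} {k₁ k₂ : ℕ}
    (hx : x ^ (k₁ + 1) = 0) (hy : y ^ (k₂ + 1) = 0) (φ : A →ₗ[ℝ] ℝ) {r s t : ℕ}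
    (hrst : r + s + t = k₁ + k₂) (hs : s ≤ k₁) (ht : t ≤ k₂) (F : Polynomial ℝ) :
    φ (homEval x y r F * (x ^ s * y ^ t)) = F.coeff (k₁ - s) * φ (x ^ k₁ * y ^ k₂) := by
  rw [homEval, Finset.sum_mul, map_sum, Finset.sum_eq_single (k₁ - s)]
  · rw [smul_mul_assoc, map_smul, smul_eq_mul]
    congr 2
    rw [mul_mul_mul_comm, ← pow_add, ← pow_add]
    congr 2 <;> omega
  · intro i hi hne
    rw [Finset.mem_range] at hi
    rw [smul_mul_assoc, mul_mul_mul_comm, ← pow_add, ← pow_add]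
    rcases Nat.lt_or_ge k₁ (i + s) with h | h
    · rw [pow_eq_zero_of_le h hx, zero_mul, smul_zero, map_zero]
    · rw [pow_eq_zero_of_le (show k₂ + 1 ≤ r - i + t by omega) hy, mul_zero, smul_zero, map_zero]
  · intro h
    exact absurd (Finset.mem_range.mpr (by omega)) h

theorem homEval_eq_zero {A : Type*} [CommRing A] [Algebra ℝ A] {x y : A} {k₁ k₂ : ℕ}
    (hx : x ^ (k₁ + 1) = 0) (hy : y ^ (k₂ + 1) = 0) {r : ℕ} {F : Polynomial ℝ}
    (hF : ∀ i ≤ k₁, r ≤ k₂ + i → F.coeff i = 0) : homEval x y r F = 0 := by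
  refine Finset.sum_eq_zero fun i hi => ?_
  rw [Finset.mem_range] at hi
  by_cases h₁ : i ≤ k₁
  · by_cases h₂ : r ≤ k₂ + i
    · rw [hF i h₁ h₂, zero_smul]
    · rw [pow_eq_zero_of_le (show k₂ + 1 ≤ r - i by omega) hy, mul_zero, smul_zero]
  · rw [pow_eq_zero_of_le (show k₁ + 1 ≤ i by omega) hx, zero_mul, smul_zero]

theorem exists_coeff_of_one_sub_X_pow_mul (m : ℕ) (e : ℝ) (q : ℕ) (P : Polynomial ℝ)
    (w : ℕ → ℝ) (hw : ∀ i, 0 < w i)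
    (h : ∀ i ≤ m, ((1 - Polynomial.X) ^ q * P).coeff i = e * w i) :
    ∃ v : ℕ → ℝ, (∀ i, 0 < v i) ∧ ∀ i ≤ m, P.coeff i = e * v i := by
  induction q generalizing w with
  | zero => exact ⟨w, hw, by simpa using h⟩
  | succ q ih =>
    refine ih (fun i => ∑ j ∈ Finset.range (i + 1), w j)
      (fun i => Finset.sum_pos (fun j _ => hw j) ⟨0, by simp⟩) fun i hi => ?_
    rw [pow_succ', mul_assoc] at h
    induction i with
    | zero =>
      have := h 0 hi
      rw [coeff_one_sub_X_mul_zero] at this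
      simpa using this
    | succ i ihi =>
      have := h (i + 1) hi
      rw [coeff_one_sub_X_mul_succ, ihi (by omega)] at this
      rw [Finset.sum_range_succ]
      linarith

theorem exists_iterate_derivative_one_sub_X_pow_mul (m p : ℕ) :
    ∀ (q : ℕ) (H : Polynomial ℝ), H.natDegree ≤ m →
    ∃ (G : Polynomial ℝ) (c : ℝ), 0 < c ∧ G.natDegree ≤ m ∧
      Polynomial.derivative^[p] ((1 - Polynomial.X) ^ (p + q) * H)
        = (1 - Polynomial.X) ^ q * G ∧
      G.eval 1 = (-1) ^ p * c * H.eval 1 ∧ (G = 0 → H = 0) := by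
  induction p with
  | zero => exact fun q H hH => ⟨H, 1, one_pos, hH, by simp, by simp, id⟩
  | succ p ih =>
    intro q H hH
    have hder : Polynomial.derivative ((1 - Polynomial.X) ^ (p + 1 + q) * H)
        = (1 - Polynomial.X) ^ (p + q)
          * ((1 - Polynomial.X) * Polynomial.derivative H
            - Polynomial.C ((p + q + 1 : ℕ) : ℝ) * H) := by
      rw [show p + 1 + q = p + q + 1 by omega, Polynomial.derivative_mul,
        Polynomial.derivative_pow]
      simp only [Polynomial.derivative_sub, Polynomial.derivative_one, Polynomial.derivative_X,
        Nat.add_sub_cancel]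
      ring
    set K := (1 - Polynomial.X) * Polynomial.derivative H
      - Polynomial.C ((p + q + 1 : ℕ) : ℝ) * H with hK
    have hKdeg : K.natDegree ≤ m := by
      rw [Polynomial.natDegree_le_iff_coeff_eq_zero]
      intro i hi
      obtain ⟨j, rfl⟩ : ∃ j, i = j + 1 := ⟨i - 1, by omega⟩
      rw [hK, Polynomial.coeff_sub, coeff_one_sub_X_mul_succ, Polynomial.coeff_C_mul,
        Polynomial.coeff_derivative, Polynomial.coeff_derivative,
        Polynomial.coeff_eq_zero_of_natDegree_lt (show H.natDegree < j + 1 by omega),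
        Polynomial.coeff_eq_zero_of_natDegree_lt (show H.natDegree < j + 1 + 1 by omega)]
      ring
    obtain ⟨G, c, hc, hG, hGder, hGeval, hG0⟩ := ih q K hKdeg
    refine ⟨G, c * (p + q + 1 : ℕ), by positivity, hG, ?_, ?_, fun h => ?_⟩
    · rw [Function.iterate_succ_apply, hder, hGder]
    · rw [hGeval, hK]
      simp only [Polynomial.eval_sub, Polynomial.eval_mul, Polynomial.eval_one, Polynomial.eval_X,
        Polynomial.eval_C]
      ring
    · rw [hG0 h, mul_zero] at hder
      have hconst := Polynomial.eq_C_of_derivative_eq_zero hder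
      have heval := congrArg (Polynomial.eval 1) hconst
      rw [Polynomial.eval_C, Polynomial.eval_mul, Polynomial.eval_pow, Polynomial.eval_sub,
        Polynomial.eval_one, Polynomial.eval_X, sub_self, zero_pow (by omega), zero_mul] at heval
      rw [← heval, Polynomial.C_0] at hconst
      exact (mul_eq_zero.mp hconst).resolve_left (pow_ne_zero _ one_sub_X_ne_zero)

theorem coeff_mul_eval_one_pos {p q m : ℕ} {H : Polynomial ℝ} (hH : H.natDegree ≤ m)
    (hH0 : H ≠ 0) {d : ℝ}
    (hd : ∀ i ≤ m, ((1 - Polynomial.X) ^ (p + q) * H).coeff (p + i) = d) :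
    0 < (-1) ^ p * (d * H.eval 1) := by
  obtain ⟨G, c, hc, hG, hder, heval, hG0⟩ := exists_iterate_derivative_one_sub_X_pow_mul m p q H hH
  obtain ⟨v, hv, hGv⟩ := exists_coeff_of_one_sub_X_pow_mul m d q G
    (fun i => ((i + p).descFactorial p : ℝ))
    (fun i => by exact_mod_cast Nat.descFactorial_pos.mpr (by omega)) fun i hi => by
      rw [← hder, Polynomial.coeff_iterate_derivative, nsmul_eq_mul, add_comm i p, hd i hi,
        mul_comm]
  have hd0 : d ≠ 0 := by
    rintro rfl
    refine hH0 (hG0 (Polynomial.ext fun i => ?_))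
    rcases le_or_gt i m with hi | hi
    · rw [hGv i hi, zero_mul, Polynomial.coeff_zero]
    · rw [Polynomial.coeff_eq_zero_of_natDegree_lt (hG.trans_lt hi), Polynomial.coeff_zero]
  have hG1 : G.eval 1 = d * ∑ i ∈ Finset.range (m + 1), v i := by
    rw [Polynomial.eval_eq_sum_range' (Nat.lt_succ_of_le hG), Finset.mul_sum]
    refine Finset.sum_congr rfl fun i hi => ?_
    rw [hGv i (by simpa [Nat.lt_succ_iff] using hi), one_pow, mul_one]
  have hS : 0 < ∑ i ∈ Finset.range (m + 1), v i :=
    Finset.sum_pos (fun j _ => hv j) ⟨0, by simp⟩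
  have hpos : 0 < c * ((-1) ^ p * (d * H.eval 1)) := by
    calc 0 < d ^ 2 * ∑ i ∈ Finset.range (m + 1), v i := by positivity
      _ = d * G.eval 1 := by rw [hG1]; ring
      _ = c * ((-1) ^ p * (d * H.eval 1)) := by rw [heval]; ring
  exact pos_of_mul_pos_right hpos hc.le

/-- The Hodge–Riemann relations for a pair of nilpotents `x`, `y` in an `ℝ`-algebra with Lefschetz
element `y - x`. -/
theorem hodgeRiemann_homEval {A : Type*} [CommRing A] [Algebra ℝ A] {x y : A} {k₁ k₂ : ℕ}
    (hx : x ^ (k₁ + 1) = 0) (hy : y ^ (k₂ + 1) = 0) (φ : A →ₗ[ℝ] ℝ)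
    (hφ : 0 < (-1) ^ k₁ * φ (x ^ k₁ * y ^ k₂)) {m : ℕ} (hm : 2 * m ≤ k₁ + k₂)
    {H : Polynomial ℝ} (hH : H.natDegree ≤ m)
    (hprim : (y - x) ^ (k₁ + k₂ - 2 * m + 1) * homEval x y m H = 0)
    (hne : homEval x y m H ≠ 0) :
    0 < (-1) ^ m
      * φ ((y - x) ^ (k₁ + k₂ - 2 * m) * (homEval x y m H * homEval x y m H)) := by
  have hκ : φ (x ^ k₁ * y ^ k₂) ≠ 0 := by
    intro h
    simp [h] at hφ
  rw [sub_pow_mul_homEval _ _ _ _ hH] at hprim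
  have hcoeff : ∀ i ≤ k₁, k₁ < i + m → i + m ≤ k₁ + k₂ + 1 →
      ((1 - Polynomial.X) ^ (k₁ + k₂ - 2 * m + 1) * H).coeff i = 0 := by
    intro i hi h₁ h₂
    have := map_homEval_mul hx hy φ (r := m + (k₁ + k₂ - 2 * m + 1)) (s := k₁ - i)
      (t := i + m - k₁ - 1) (by omega) (by omega) (by omega)
      ((1 - Polynomial.X) ^ (k₁ + k₂ - 2 * m + 1) * H)
    rw [hprim, zero_mul, map_zero, show k₁ - (k₁ - i) = i by omega] at this
    exact (mul_eq_zero.mp this.symm).resolve_right hκ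
  have hH0 : H ≠ 0 := by
    rintro rfl
    exact hne (by simp [homEval])
  have hk₁ : m ≤ k₁ := by
    by_contra! hlt
    have hdvd : (Polynomial.X : Polynomial ℝ) ^ (k₁ + 1)
        ∣ (1 - Polynomial.X) ^ (k₁ + k₂ - 2 * m + 1) * H :=
      Polynomial.X_pow_dvd_iff.mpr fun i hi => hcoeff i (by omega) (by omega) (by omega)
    have hcop : IsCoprime ((Polynomial.X : Polynomial ℝ) ^ (k₁ + 1))
        ((1 - Polynomial.X) ^ (k₁ + k₂ - 2 * m + 1)) :=
      IsCoprime.pow ⟨1, 1, by ring⟩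
    have := Polynomial.X_pow_dvd_iff.mp (hcop.dvd_of_dvd_mul_left hdvd)
    exact hne (homEval_eq_zero hx hy fun i hi _ => this i (by omega))
  have hk₂ : m ≤ k₂ := by
    by_contra! hlt
    have hdeg : ((1 - Polynomial.X) ^ (k₁ + k₂ - 2 * m + 1) * H).natDegree
        = k₁ + k₂ - 2 * m + 1 + H.natDegree := by
      rw [Polynomial.natDegree_mul (pow_ne_zero _ one_sub_X_ne_zero) hH0, natDegree_one_sub_X_pow]
    have hle : ((1 - Polynomial.X) ^ (k₁ + k₂ - 2 * m + 1) * H).natDegree ≤ k₁ - m := by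
      rw [Polynomial.natDegree_le_iff_coeff_eq_zero]
      intro i hi
      by_cases h : i ≤ k₁ ∧ i + m ≤ k₁ + k₂ + 1
      · exact hcoeff i h.1 (by omega) h.2
      · exact Polynomial.coeff_eq_zero_of_natDegree_lt (by omega)
    exact hne (homEval_eq_zero hx hy fun i _ hi =>
      Polynomial.coeff_eq_zero_of_natDegree_lt (by omega))
  set F := (1 - Polynomial.X) ^ (k₁ + k₂ - 2 * m) * H with hF
  have hconst : ∀ i ≤ m, F.coeff (k₁ - m + i) = F.coeff (k₁ - m) := by
    intro i
    induction i with
    | zero => simp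
    | succ i ih =>
      intro hi
      have := hcoeff (k₁ - m + i + 1) (by omega) (by omega) (by omega)
      rw [pow_succ', mul_assoc, coeff_one_sub_X_mul_succ, ← hF, ih (by omega), sub_eq_zero] at this
      exact this
  have hpos : 0 < (-1) ^ (k₁ - m) * (F.coeff (k₁ - m) * H.eval 1) :=
    coeff_mul_eval_one_pos (q := k₂ - m) hH hH0 (by
      rwa [show k₁ - m + (k₂ - m) = k₁ + k₂ - 2 * m by omega])
  have hval : φ ((y - x) ^ (k₁ + k₂ - 2 * m) * (homEval x y m H * homEval x y m H))
      = F.coeff (k₁ - m) * H.eval 1 * φ (x ^ k₁ * y ^ k₂) := by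
    rw [← mul_assoc, sub_pow_mul_homEval _ _ _ _ hH, ← hF]
    conv_lhs => rw [homEval.eq_def x y m H]
    rw [Finset.mul_sum, map_sum, Polynomial.eval_eq_sum_range' (Nat.lt_succ_of_le hH),
      Finset.mul_sum, Finset.sum_mul]
    refine Finset.sum_congr rfl fun i hi => ?_
    rw [Finset.mem_range] at hi
    rw [mul_smul_comm, map_smul, map_homEval_mul hx hy φ (by omega) (by omega) (by omega),
      show k₁ - i = k₁ - m + (m - i) by omega, hconst _ (by omega), one_pow, smul_eq_mul]
    ring
  rw [hval]
  have hsign : ((-1 : ℝ) ^ m) = (-1) ^ (k₁ - m) * (-1) ^ k₁ := by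
    rw [← pow_add, show k₁ - m + k₁ = m + 2 * (k₁ - m) by omega, pow_add, pow_mul]
    simp
  calc 0 < (-1) ^ (k₁ - m) * (F.coeff (k₁ - m) * H.eval 1)
        * ((-1) ^ k₁ * φ (x ^ k₁ * y ^ k₂)) := mul_pos hpos hφ
    _ = _ := by rw [hsign]; ring

theorem exists_homEval_of_mem_Rm {k₁ k₂ m : ℕ} {α β : ℝ} (hα : α ≠ 0) (hβ : β ≠ 0)
    {h : QR k₁ k₂} (hh : h ∈ Rm k₁ k₂ m) :
    ∃ H : Polynomial ℝ, H.natDegree ≤ m ∧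
      h = homEval (α • Ideal.Quotient.mk (projIdeal k₁ k₂) (X 0))
        (β • Ideal.Quotient.mk (projIdeal k₁ k₂) (X 1)) m H := by
  induction hh using Submodule.span_induction with
  | mem q hq =>
    obtain ⟨i, j, rfl, rfl⟩ := hq
    refine ⟨Polynomial.monomial i ((α ^ i * β ^ j)⁻¹),
      (Polynomial.natDegree_monomial_le _).trans (by omega), ?_⟩
    rw [homEval, Finset.sum_eq_single i]
    · rw [Polynomial.coeff_monomial_same, smul_pow, smul_pow, smul_mul_smul_comm, smul_smul,
        show i + j - i = j by omega, inv_mul_cancel₀ (by positivity), one_smul, map_mul, map_pow,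
        map_pow]
    · intro l _ hl
      rw [Polynomial.coeff_monomial_of_ne _ hl, zero_smul]
    · intro hi
      exact absurd (Finset.mem_range.mpr (by omega)) hi
  | zero => exact ⟨0, by simp, by simp [homEval]⟩
  | add u v _ _ hu hv =>
    obtain ⟨U, hU, rfl⟩ := hu
    obtain ⟨V, hV, rfl⟩ := hv
    exact ⟨U + V, Polynomial.natDegree_add_le_of_degree_le hU hV, by
      simp only [homEval, Polynomial.coeff_add, add_smul, Finset.sum_add_distrib]⟩
  | smul c u _ hu =>
    obtain ⟨U, hU, rfl⟩ := hu
    exact ⟨c • U, (Polynomial.natDegree_smul_le c U).trans hU, by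
      simp only [homEval, Polynomial.coeff_smul, Finset.smul_sum, smul_assoc]⟩

/-- Hodge–Riemann relations for `ℝ[x,y]/(x^{k₁+1}, y^{k₂+1})`: with
`n = k₁ + k₂`, `λ = a·x + b·y` (`a, b > 0`) and the evaluation map
`⟨·⟩ : R_n → ℝ` normalized by `⟨x^{k₁} y^{k₂}⟩ = 1`, the quadratic form
`h ↦ (−1)^m ⟨λ^{n−2m} h²⟩` is positive definite on the primitive subspace
`{h ∈ R_m : λ^{n−2m+1} h = 0}` for every `0 ≤ m ≤ n/2`. -/
theorem stmt8 (k₁ k₂ : ℕ) (a b : ℝ) (ha : 0 < a) (hb : 0 < b)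
    (lam : QR k₁ k₂)
    (hlam : lam = a • Ideal.Quotient.mk (projIdeal k₁ k₂) (X 0)
                + b • Ideal.Quotient.mk (projIdeal k₁ k₂) (X 1))
    (ev : QR k₁ k₂ →ₗ[ℝ] ℝ)
    (hev : ev (Ideal.Quotient.mk (projIdeal k₁ k₂) (X 0 ^ k₁ * X 1 ^ k₂)) = 1)
    (m : ℕ) (hm : 2 * m ≤ k₁ + k₂) :
    ∀ h ∈ Rm k₁ k₂ m, lam ^ (k₁ + k₂ - 2 * m + 1) * h = 0 → h ≠ 0 →
      0 < (-1 : ℝ) ^ m * ev (lam ^ (k₁ + k₂ - 2 * m) * (h * h)) := by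
  intro h hh hprim hne
  obtain ⟨H, hH, rfl⟩ := exists_homEval_of_mem_Rm (neg_ne_zero.mpr ha.ne') hb.ne' hh
  have hlam' : lam = b • Ideal.Quotient.mk (projIdeal k₁ k₂) (X 1)
      - (-a) • Ideal.Quotient.mk (projIdeal k₁ k₂) (X 0) := by
    rw [hlam, neg_smul, sub_neg_eq_add, add_comm]
  rw [hlam'] at hprim ⊢
  refine hodgeRiemann_homEval ?_ ?_ ev ?_ hm hH hprim hne
  · rw [smul_pow, ← map_pow, Ideal.Quotient.eq_zero_iff_mem.mpr (Ideal.subset_span (by simp)),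
      smul_zero]
  · rw [smul_pow, ← map_pow, Ideal.Quotient.eq_zero_iff_mem.mpr (Ideal.subset_span (by simp)),
      smul_zero]
  · rw [smul_pow, smul_pow, smul_mul_smul_comm, ← map_pow, ← map_pow, ← map_mul, map_smul, hev,
      smul_eq_mul, mul_one, ← mul_assoc, ← mul_pow, neg_one_mul, neg_neg]
    positivity
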